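/- Let (λ,H) be a punctured partition whose holes all lie in the first column. Then for every semistandard punctured tableau T of shape (λ,H), the row-word of Rect(T) is Knuth equivalent to the column-word of T. -/

import Mathlib

open scoped Classical

/-- A partition recorded by its parts `λ_i = f i` for `i ≥ 1`. -/
def IsPartitionF (f : ℕ → ℕ) : Prop :=
  (∀ i j, 1 ≤ i → i ≤ j → f j ≤ f i) ∧ ∃ N, ∀ i, N < i → f i = 0

/-- The Young diagram `D(λ)` of a partition. -/
def cells (f : ℕ → ℕ) : Set (ℕ × ℕ) := {p | 1 ≤ p.1 ∧ 1 ≤ p.2 ∧ p.2 ≤ f p.1}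

/-- A punctured tableau of shape `(λ,H)`, recorded as a function `T : ℕ×ℕ → ℕ` which
takes positive values exactly on `D(λ,H) = D(λ) \ H` (and `0` elsewhere). -/
def PTab (f : ℕ → ℕ) (H : Set (ℕ × ℕ)) (T : ℕ × ℕ → ℕ) : Prop :=
  (∀ p, p ∉ cells f \ H → T p = 0) ∧ (∀ p ∈ cells f \ H, 1 ≤ T p)

/-- A semistandard punctured tableau: entries weakly increase along rows and strictly
increase down columns (comparisons among filled cells). -/
def PSSYT (f : ℕ → ℕ) (H : Set (ℕ × ℕ)) (T : ℕ × ℕ → ℕ) : Prop :=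
  PTab f H T ∧
  (∀ i j l, (i, j) ∈ cells f \ H → (i, l) ∈ cells f \ H → j < l → T (i, j) ≤ T (i, l)) ∧
  (∀ i k j, (i, j) ∈ cells f \ H → (k, j) ∈ cells f \ H → i < k → T (i, j) < T (k, j))

/-- The row-word: entries read left-to-right along rows, bottom row to top, skipping
holes; `N` is any bound on the number of rows. -/
noncomputable def rowWordP (f : ℕ → ℕ) (H : Set (ℕ × ℕ)) (T : ℕ × ℕ → ℕ) (N : ℕ) :
    List ℕ :=
  ((List.range N).reverse.map (fun i =>
    ((((List.range (f (i + 1))).map (· + 1)).filter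
        (fun j => decide ((i + 1, j) ∉ H))).map (fun j => T (i + 1, j))))).flatten

/-- The column-word: entries of each column read bottom-to-top, columns left to right,
skipping holes; `N` bounds the number of rows, `M` the number of columns. -/
noncomputable def colWordP (f : ℕ → ℕ) (H : Set (ℕ × ℕ)) (T : ℕ × ℕ → ℕ) (N M : ℕ) :
    List ℕ :=
  ((List.range M).map (fun j =>
    ((((List.range N).reverse.map (· + 1)).filter
        (fun i => decide ((i, j + 1) ∈ cells f \ H))).map (fun i => T (i, j + 1))))).flatten

/-- Elementary Knuth transformations on three consecutive letters:
(K1) `yzx ↦ yxz` if `x < y ≤ z`; (K2) `xzy ↦ zxy` if `x ≤ y < z`. -/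
inductive KnuthStep : List ℕ → List ℕ → Prop
  | K1 (a b : List ℕ) (x y z : ℕ) (h1 : x < y) (h2 : y ≤ z) :
      KnuthStep (a ++ y :: z :: x :: b) (a ++ y :: x :: z :: b)
  | K2 (a b : List ℕ) (x y z : ℕ) (h1 : x ≤ y) (h2 : y < z) :
      KnuthStep (a ++ x :: z :: y :: b) (a ++ z :: x :: y :: b)

/-- Knuth equivalence of words. -/
def Knuth : List ℕ → List ℕ → Prop := Relation.EqvGen KnuthStep

/-- A hole `p ∈ H` is slidable if the cell to its right or below belongs to `D(λ,H)`. -/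
def Slidable (f : ℕ → ℕ) (H : Set (ℕ × ℕ)) (p : ℕ × ℕ) : Prop :=
  p ∈ H ∧ ((p.1, p.2 + 1) ∈ cells f \ H ∨ (p.1 + 1, p.2) ∈ cells f \ H)

/-- A hole `p ∈ H` is reversely slidable if the cell to its left or above belongs to
`D(λ,H)`. -/
def RevSlidable (f : ℕ → ℕ) (H : Set (ℕ × ℕ)) (p : ℕ × ℕ) : Prop :=
  p ∈ H ∧ ((p.1, p.2 - 1) ∈ cells f \ H ∨ (p.1 - 1, p.2) ∈ cells f \ H)

/-- Move the hole from `p` to the filled cell `q`: the entry at `q` moves into `p`, and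
`q` becomes the new hole (set to `0`). -/
noncomputable def moveHole (H : Set (ℕ × ℕ)) (T : ℕ × ℕ → ℕ) (p q : ℕ × ℕ) :
    Set (ℕ × ℕ) × (ℕ × ℕ → ℕ) :=
  ((H \ {p}) ∪ {q}, Function.update (Function.update T p (T q)) q 0)

/-- One step of the Schützenberger sliding: the state is `(H, T, hole)`.  The hole moves
right if the entry to the right is strictly smaller than the entry below (or there is no
entry below), and moves down otherwise (when there is an entry below). -/
def SlideStep (f : ℕ → ℕ) :
    (Set (ℕ × ℕ) × (ℕ × ℕ → ℕ) × (ℕ × ℕ)) → (Set (ℕ × ℕ) × (ℕ × ℕ → ℕ) × (ℕ × ℕ)) → Prop :=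
  fun s t =>
    ((s.2.2.1, s.2.2.2 + 1) ∈ cells f \ s.1 ∧
      ((s.2.2.1 + 1, s.2.2.2) ∈ cells f \ s.1 →
        s.2.1 (s.2.2.1, s.2.2.2 + 1) < s.2.1 (s.2.2.1 + 1, s.2.2.2)) ∧
      t = ((moveHole s.1 s.2.1 s.2.2 (s.2.2.1, s.2.2.2 + 1)).1,
           (moveHole s.1 s.2.1 s.2.2 (s.2.2.1, s.2.2.2 + 1)).2, (s.2.2.1, s.2.2.2 + 1)))
  ∨ ((s.2.2.1 + 1, s.2.2.2) ∈ cells f \ s.1 ∧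
      ((s.2.2.1, s.2.2.2 + 1) ∈ cells f \ s.1 →
        s.2.1 (s.2.2.1 + 1, s.2.2.2) ≤ s.2.1 (s.2.2.1, s.2.2.2 + 1)) ∧
      t = ((moveHole s.1 s.2.1 s.2.2 (s.2.2.1 + 1, s.2.2.2)).1,
           (moveHole s.1 s.2.1 s.2.2 (s.2.2.1 + 1, s.2.2.2)).2, (s.2.2.1 + 1, s.2.2.2)))

/-- One step of the reverse sliding: the hole moves left if the entry to the left is
strictly greater than the entry above (or there is no entry above), and moves up
otherwise (when there is an entry above). -/
def RevSlideStep (f : ℕ → ℕ) :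
    (Set (ℕ × ℕ) × (ℕ × ℕ → ℕ) × (ℕ × ℕ)) → (Set (ℕ × ℕ) × (ℕ × ℕ → ℕ) × (ℕ × ℕ)) → Prop :=
  fun s t =>
    ((s.2.2.1, s.2.2.2 - 1) ∈ cells f \ s.1 ∧
      ((s.2.2.1 - 1, s.2.2.2) ∈ cells f \ s.1 →
        s.2.1 (s.2.2.1 - 1, s.2.2.2) < s.2.1 (s.2.2.1, s.2.2.2 - 1)) ∧
      t = ((moveHole s.1 s.2.1 s.2.2 (s.2.2.1, s.2.2.2 - 1)).1,
           (moveHole s.1 s.2.1 s.2.2 (s.2.2.1, s.2.2.2 - 1)).2, (s.2.2.1, s.2.2.2 - 1)))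
  ∨ ((s.2.2.1 - 1, s.2.2.2) ∈ cells f \ s.1 ∧
      ((s.2.2.1, s.2.2.2 - 1) ∈ cells f \ s.1 →
        s.2.1 (s.2.2.1, s.2.2.2 - 1) ≤ s.2.1 (s.2.2.1 - 1, s.2.2.2)) ∧
      t = ((moveHole s.1 s.2.1 s.2.2 (s.2.2.1 - 1, s.2.2.2)).1,
           (moveHole s.1 s.2.1 s.2.2 (s.2.2.1 - 1, s.2.2.2)).2, (s.2.2.1 - 1, s.2.2.2)))

/-- `p` is the latest slidable hole with respect to the lexicographic order. -/
def LatestSlidable (f : ℕ → ℕ) (H : Set (ℕ × ℕ)) (p : ℕ × ℕ) : Prop :=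
  Slidable f H p ∧ ∀ q, Slidable f H q → q.1 < p.1 ∨ (q.1 = p.1 ∧ q.2 ≤ p.2)

/-- `p` is the first reversely slidable hole with respect to the lexicographic order. -/
def FirstRevSlidable (f : ℕ → ℕ) (H : Set (ℕ × ℕ)) (p : ℕ × ℕ) : Prop :=
  RevSlidable f H p ∧ ∀ q, RevSlidable f H q → p.1 < q.1 ∨ (p.1 = q.1 ∧ p.2 ≤ q.2)

/-- One step of the rectification: perform the full sliding `Sl(T;r,c)` at the latest
slidable hole `(r,c)`. -/
def RectStep (f : ℕ → ℕ) :
    (Set (ℕ × ℕ) × (ℕ × ℕ → ℕ)) → (Set (ℕ × ℕ) × (ℕ × ℕ → ℕ)) → Prop :=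
  fun s t => ∃ p p', LatestSlidable f s.1 p ∧
    Relation.ReflTransGen (SlideStep f) (s.1, s.2, p) (t.1, t.2, p') ∧
    ¬ Slidable f t.1 p'

/-- One step of the reverse rectification: perform the full reverse sliding at the first
reversely slidable hole. -/
def RevRectStep (f : ℕ → ℕ) :
    (Set (ℕ × ℕ) × (ℕ × ℕ → ℕ)) → (Set (ℕ × ℕ) × (ℕ × ℕ → ℕ)) → Prop :=
  fun s t => ∃ p p', FirstRevSlidable f s.1 p ∧
    Relation.ReflTransGen (RevSlideStep f) (s.1, s.2, p) (t.1, t.2, p') ∧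
    ¬ RevSlidable f t.1 p'

/-! ### Knuth equivalence -/

theorem Knuth.refl (u : List ℕ) : Knuth u u := Relation.EqvGen.refl u

theorem Knuth.symm {u v : List ℕ} (h : Knuth u v) : Knuth v u := Relation.EqvGen.symm _ _ h

theorem Knuth.trans {u v w : List ℕ} (h : Knuth u v) (h' : Knuth v w) : Knuth u w :=
  Relation.EqvGen.trans _ _ _ h h'

theorem Knuth.of_eq {u v : List ℕ} (h : u = v) : Knuth u v := h ▸ Knuth.refl u

theorem KnuthStep.context {u v : List ℕ} (h : KnuthStep u v) (p s : List ℕ) :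
    KnuthStep (p ++ u ++ s) (p ++ v ++ s) := by
  cases h with
  | K1 a b x y z h1 h2 => simpa using KnuthStep.K1 (p ++ a) (b ++ s) x y z h1 h2
  | K2 a b x y z h1 h2 => simpa using KnuthStep.K2 (p ++ a) (b ++ s) x y z h1 h2

theorem Knuth.context {u v : List ℕ} (h : Knuth u v) (p s : List ℕ) :
    Knuth (p ++ u ++ s) (p ++ v ++ s) := by
  induction h with
  | rel _ _ h => exact Relation.EqvGen.rel _ _ (h.context p s)
  | refl => exact Knuth.refl _
  | symm _ _ _ ih => exact ih.symm
  | trans _ _ _ _ _ ih ih' => exact ih.trans ih'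

theorem Knuth.append_left {u v : List ℕ} (h : Knuth u v) (p : List ℕ) :
    Knuth (p ++ u) (p ++ v) := by
  simpa using h.context p []

theorem Knuth.append_right {u v : List ℕ} (h : Knuth u v) (s : List ℕ) :
    Knuth (u ++ s) (v ++ s) := by
  simpa using h.context [] s

theorem Knuth.cons {u v : List ℕ} (h : Knuth u v) (x : ℕ) : Knuth (x :: u) (x :: v) :=
  h.append_left [x]

/-- A small letter moves to the right through a strictly decreasing word. -/
theorem knuth_letter_through (x c : ℕ) (hxc : x ≤ c) (E : List ℕ)
    (hE : (E ++ [c]).Pairwise (· > ·)) : Knuth (x :: (E ++ [c])) (E ++ [x, c]) := by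
  induction E with
  | nil => exact Knuth.refl _
  | cons e E ih =>
    have hE' : (E ++ [c]).Pairwise (· > ·) := (List.pairwise_cons.1 hE).2
    refine Knuth.trans ?_ ((ih hE').cons e)
    obtain ⟨d, R, hd, hxd⟩ : ∃ d R, E ++ [c] = d :: R ∧ x ≤ d := by
      cases E with
      | nil => exact ⟨c, [], rfl, hxc⟩
      | cons d R =>
        refine ⟨d, R ++ [c], rfl, ?_⟩
        have := (List.pairwise_cons.1 hE').1 c (by simp)
        omega
    have hed : d < e := (List.pairwise_cons.1 hE).1 d (by simp [hd])
    rw [List.cons_append, hd]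
    exact Relation.EqvGen.rel _ _ (KnuthStep.K2 [] R x d e hxd hed)

/-- A large letter moves to the right through a strictly decreasing word. -/
theorem knuth_letter_past (y z : ℕ) (hyz : y ≤ z) (F : List ℕ)
    (hF : (y :: F).Pairwise (· > ·)) : Knuth (y :: z :: F) (y :: (F ++ [z])) := by
  induction F generalizing y with
  | nil => exact Knuth.refl _
  | cons e F ih =>
    have hey : e < y := (List.pairwise_cons.1 hF).1 e (by simp)
    refine Knuth.trans ?_ ((ih e (by omega) (List.pairwise_cons.1 hF).2).cons y)
    exact Relation.EqvGen.rel _ _ (KnuthStep.K1 [] F e y z hey hyz)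

/-- A word commutes with a decreasing word in front of a column dominating it. -/
theorem knuth_commute_before {X C : List ℕ} (h : List.SublistForall₂ (· ≤ ·) X C) (D : List ℕ)
    (hDC : (D ++ C).Pairwise (· > ·)) : Knuth (X ++ (D ++ C)) (D ++ (X ++ C)) := by
  induction h generalizing D with
  | nil => exact Knuth.refl _
  | @cons x c X C hxc _ ih =>
    have hc : ([c] ++ C).Pairwise (· > ·) := (List.pairwise_append.1 hDC).2.1
    have hDc : (D ++ [c]).Pairwise (· > ·) :=
      hDC.sublist (by simp)
    have h1 : Knuth (x :: (X ++ (D ++ c :: C))) (x :: (D ++ c :: (X ++ C))) := by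
      simpa using (ih (D ++ [c]) (by simpa using hDC)).cons x
    have h2 : Knuth (x :: (D ++ c :: (X ++ C))) (D ++ x :: c :: (X ++ C)) := by
      simpa using (knuth_letter_through x c hxc D hDc).append_right (X ++ C)
    have h3 : Knuth (D ++ x :: c :: (X ++ C)) (D ++ x :: (X ++ c :: C)) := by
      simpa using ((ih [c] hc).symm.cons x).append_left D
    exact (h1.trans h2).trans h3
  | @cons_right c X C _ ih =>
    have hc : ([c] ++ C).Pairwise (· > ·) := (List.pairwise_append.1 hDC).2.1
    have h1 : Knuth (X ++ (D ++ c :: C)) (D ++ c :: (X ++ C)) := by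
      simpa using ih (D ++ [c]) (by simpa using hDC)
    have h2 : Knuth (D ++ c :: (X ++ C)) (D ++ (X ++ c :: C)) := by
      simpa using (ih [c] hc).symm.append_left D
    exact h1.trans h2

/-- A word commutes with a decreasing word behind a column dominated by it. -/
theorem knuth_commute_after {Z Y : List ℕ} (h : List.SublistForall₂ (· ≥ ·) Z Y) (E : List ℕ)
    (hYE : (Y ++ E).Pairwise (· > ·)) : Knuth (Y ++ (E ++ Z)) (Y ++ (Z ++ E)) := by
  induction h with
  | nil => simpa using Knuth.refl _
  | @cons z y Z Y hzy _ ih =>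
    have hY : (y :: Y).Pairwise (· > ·) := (List.pairwise_append.1 hYE).1
    have h1 : Knuth (y :: (Y ++ (E ++ z :: Z))) (y :: z :: (Y ++ (E ++ Z))) := by
      simpa using (knuth_letter_past y z hzy (Y ++ E) hYE).symm.append_right Z
    have h2 : Knuth (y :: z :: (Y ++ (E ++ Z))) (y :: z :: (Y ++ (Z ++ E))) :=
      ((ih (List.pairwise_cons.1 hYE).2).cons z).cons y
    have h3 : Knuth (y :: z :: (Y ++ (Z ++ E))) (y :: (Y ++ (z :: Z ++ E))) := by
      simpa using (knuth_letter_past y z hzy Y hY).append_right (Z ++ E)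
    exact (h1.trans h2).trans h3
  | @cons_right y Z Y _ ih =>
    exact (ih (List.pairwise_cons.1 hYE).2).cons y

/-- The Knuth equivalence behind a horizontal move of the letter `a` between two columns. -/
theorem knuth_two_columns {Y X B C : List ℕ} {a : ℕ}
    (hYX : (Y ++ a :: X).Pairwise (· > ·)) (hC : (a :: C).Pairwise (· > ·))
    (hBY : List.SublistForall₂ (· ≥ ·) B Y) (hXC : List.SublistForall₂ (· ≤ ·) X C) :
    Knuth ((Y ++ X) ++ (B ++ a :: C)) ((Y ++ a :: X) ++ (B ++ C)) := by
  have h1 : Knuth ((Y ++ X) ++ (B ++ a :: C)) (Y ++ (B ++ (X ++ a :: C))) := by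
    have hYX' : (Y ++ X).Pairwise (· > ·) := hYX.sublist (by simp)
    simpa using (knuth_commute_after hBY X hYX').append_right (a :: C)
  have h2 : Knuth (Y ++ (B ++ (X ++ a :: C))) (Y ++ (B ++ (a :: X ++ C))) := by
    simpa using ((knuth_commute_before hXC [a] hC).append_left B).append_left Y
  have h3 : Knuth (Y ++ (B ++ (a :: X ++ C))) ((Y ++ a :: X) ++ (B ++ C)) := by
    simpa using (knuth_commute_after hBY (a :: X) hYX).symm.append_right C
  exact (h1.trans h2).trans h3

/-- A weakly increasing word commutes with a column whose top entry `c` extends it. -/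
theorem knuth_row_through_column (w E : List ℕ) (c : ℕ) (hw : (w ++ [c]).Pairwise (· ≤ ·))
    (hE : (E ++ [c]).Pairwise (· > ·)) : Knuth (w ++ (E ++ [c])) (E ++ (w ++ [c])) := by
  induction w using List.reverseRecOn generalizing c with
  | nil => exact Knuth.refl _
  | append_singleton w x ih =>
    have hxc : x ≤ c := (List.pairwise_append.1 hw).2.2 x (by simp) c (by simp)
    have hEx : (E ++ [x]).Pairwise (· > ·) := by
      rw [List.pairwise_append] at hE ⊢
      refine ⟨hE.1, by simp, fun e he d hd => ?_⟩
      have := hE.2.2 e he c (by simp)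
      simp only [List.mem_singleton] at hd
      omega
    have h1 : Knuth (w ++ [x] ++ (E ++ [c])) (w ++ (E ++ [x]) ++ [c]) := by
      simpa using (knuth_letter_through x c hxc E hE).append_left w
    have h2 : Knuth (w ++ (E ++ [x]) ++ [c]) (E ++ (w ++ [x] ++ [c])) := by
      simpa using (ih x (List.pairwise_append.1 hw).1 hEx).append_right [c]
    exact h1.trans h2

/-! ### Columns and rows of a filled set of cells -/

/-- The entries of column `j` in the filled cells `F`, with the rows listed by `L`. -/
noncomputable def colEntries (F : Set (ℕ × ℕ)) (T : ℕ × ℕ → ℕ) (L : List ℕ) (j : ℕ) : List ℕ :=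
  (L.filter (fun i => decide ((i, j) ∈ F))).map (fun i => T (i, j))

/-- The entries of row `i` in the filled cells `F`, with the columns listed by `J`. -/
noncomputable def rowEntries (F : Set (ℕ × ℕ)) (T : ℕ × ℕ → ℕ) (J : List ℕ) (i : ℕ) : List ℕ :=
  (J.filter (fun j => decide ((i, j) ∈ F))).map (fun j => T (i, j))

/-- Entries in the filled cells `F` increase weakly along rows and strictly down columns. -/
def Semistandard (F : Set (ℕ × ℕ)) (T : ℕ × ℕ → ℕ) : Prop :=
  (∀ i j l, (i, j) ∈ F → (i, l) ∈ F → j < l → T (i, j) ≤ T (i, l)) ∧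
  (∀ i k j, (i, j) ∈ F → (k, j) ∈ F → i < k → T (i, j) < T (k, j))

theorem colEntries_append (F : Set (ℕ × ℕ)) (T : ℕ × ℕ → ℕ) (L L' : List ℕ) (j : ℕ) :
    colEntries F T (L ++ L') j = colEntries F T L j ++ colEntries F T L' j := by
  simp [colEntries]

theorem rowEntries_append (F : Set (ℕ × ℕ)) (T : ℕ × ℕ → ℕ) (J J' : List ℕ) (i : ℕ) :
    rowEntries F T (J ++ J') i = rowEntries F T J i ++ rowEntries F T J' i := by
  simp [rowEntries]

theorem colEntries_cons_of_mem {F : Set (ℕ × ℕ)} (T : ℕ × ℕ → ℕ) {i j : ℕ} (L : List ℕ)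
    (h : (i, j) ∈ F) : colEntries F T (i :: L) j = T (i, j) :: colEntries F T L j := by
  simp [colEntries, h]

theorem colEntries_cons_of_notMem {F : Set (ℕ × ℕ)} (T : ℕ × ℕ → ℕ) {i j : ℕ} (L : List ℕ)
    (h : (i, j) ∉ F) : colEntries F T (i :: L) j = colEntries F T L j := by
  simp [colEntries, h]

theorem colEntries_congr {F F' : Set (ℕ × ℕ)} {T T' : ℕ × ℕ → ℕ} {L : List ℕ} {j : ℕ}
    (h : ∀ i ∈ L, ((i, j) ∈ F ↔ (i, j) ∈ F') ∧ T (i, j) = T' (i, j)) :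
    colEntries F T L j = colEntries F' T' L j := by
  unfold colEntries
  rw [List.filter_congr (q := fun i => decide ((i, j) ∈ F')) fun i hi => by simp [(h i hi).1]]
  exact List.map_congr_left fun i hi => (h i (List.mem_filter.1 hi).1).2

theorem Semistandard.colEntries_pairwise {F : Set (ℕ × ℕ)} {T : ℕ × ℕ → ℕ}
    (hT : Semistandard F T) {L : List ℕ} (hL : L.Pairwise (· > ·)) (j : ℕ) :
    (colEntries F T L j).Pairwise (· > ·) := by
  unfold colEntries
  rw [List.pairwise_map]
  refine (hL.filter _).imp_of_mem fun {i k} hi hk hik => ?_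
  simp only [List.mem_filter, decide_eq_true_eq] at hi hk
  exact hT.2 k i j hk.2 hi.2 hik

theorem Semistandard.rowEntries_pairwise {F : Set (ℕ × ℕ)} {T : ℕ × ℕ → ℕ}
    (hT : Semistandard F T) {J : List ℕ} (hJ : J.Pairwise (· < ·)) (i : ℕ) :
    (rowEntries F T J i).Pairwise (· ≤ ·) := by
  unfold rowEntries
  rw [List.pairwise_map]
  refine (hJ.filter _).imp_of_mem fun {j l} hj hl hjl => ?_
  simp only [List.mem_filter, decide_eq_true_eq] at hj hl
  exact hT.1 i j l hj.2 hl.2 hjl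

theorem colEntries_sublistForall₂ {R : ℕ → ℕ → Prop} {F : Set (ℕ × ℕ)} {T : ℕ × ℕ → ℕ}
    {L : List ℕ} {j l : ℕ}
    (h : ∀ i ∈ L, (i, j) ∈ F → (i, l) ∈ F ∧ R (T (i, j)) (T (i, l))) :
    List.SublistForall₂ R (colEntries F T L j) (colEntries F T L l) := by
  induction L with
  | nil => exact List.SublistForall₂.nil
  | cons i L ih =>
    have ih := ih fun k hk => h k (List.mem_cons_of_mem _ hk)
    by_cases hj : (i, j) ∈ F
    · obtain ⟨hl, hR⟩ := h i (by simp) hj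
      rw [colEntries_cons_of_mem T L hj, colEntries_cons_of_mem T L hl]
      exact List.SublistForall₂.cons hR ih
    · rw [colEntries_cons_of_notMem T L hj]
      by_cases hl : (i, l) ∈ F
      · rw [colEntries_cons_of_mem T L hl]
        exact List.SublistForall₂.cons_right ih
      · rwa [colEntries_cons_of_notMem T L hl]

/-- Splitting off the top row of a column reading. -/
theorem knuth_split_top_row {F : Set (ℕ × ℕ)} {T : ℕ × ℕ → ℕ} (hT : Semistandard F T)
    {L : List ℕ} {r : ℕ} (hL : (L ++ [r]).Pairwise (· > ·))
    (hF : ∀ i ∈ L, ∀ j, (i, j) ∈ F → (r, j) ∈ F) (J : List ℕ) (hJ : J.Pairwise (· < ·)) :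
    Knuth (J.map (colEntries F T (L ++ [r]))).flatten
      ((J.map (colEntries F T L)).flatten ++ rowEntries F T J r) := by
  induction J using List.reverseRecOn with
  | nil => exact Knuth.refl _
  | append_singleton J j ih =>
    have h1 := (ih (List.pairwise_append.1 hJ).1).append_right (colEntries F T (L ++ [r]) j)
    by_cases hj : (r, j) ∈ F
    · have hcol : colEntries F T (L ++ [r]) j = colEntries F T L j ++ [T (r, j)] := by
        simp [colEntries, hj]
      have hrow : rowEntries F T (J ++ [j]) r = rowEntries F T J r ++ [T (r, j)] := by
        simp [rowEntries, hj]
      have h2 := knuth_row_through_column (rowEntries F T J r) (colEntries F T L j) (T (r, j))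
        (hrow ▸ hT.rowEntries_pairwise hJ r) (hcol ▸ hT.colEntries_pairwise hL j)
      refine Knuth.trans (Knuth.of_eq (by simp)) (h1.trans ?_)
      rw [hcol, hrow]
      simpa using h2.append_left (J.map (colEntries F T L)).flatten
    · have hcol : colEntries F T L j = [] := by
        simp only [colEntries, List.map_eq_nil_iff, List.filter_eq_nil_iff, decide_eq_true_eq]
        exact fun i hi h => hj (hF i hi j h)
      have hcol' : colEntries F T (L ++ [r]) j = [] := by
        rw [colEntries_append, hcol]
        simp [colEntries, hj]
      have hrow : rowEntries F T (J ++ [j]) r = rowEntries F T J r := by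
        simp [rowEntries, hj]
      rw [hcol'] at h1
      simpa [hcol, hcol', hrow] using h1

/-- For a top-justified semistandard filling, the column and the row reading are equivalent. -/
theorem knuth_column_reading_row_reading {F : Set (ℕ × ℕ)} {T : ℕ × ℕ → ℕ}
    (hT : Semistandard F T) (L : List ℕ) (hL : L.Pairwise (· > ·))
    (hF : ∀ i ∈ L, ∀ k ∈ L, k ≤ i → ∀ j, (i, j) ∈ F → (k, j) ∈ F)
    (J : List ℕ) (hJ : J.Pairwise (· < ·)) :
    Knuth (J.map (colEntries F T L)).flatten (L.map (rowEntries F T J)).flatten := by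
  induction L using List.reverseRecOn with
  | nil => exact Knuth.of_eq (by simp [colEntries])
  | append_singleton L r ih =>
    have hL' := List.pairwise_append.1 hL
    have h1 := knuth_split_top_row hT hL
      (fun i hi => hF i (by simp [hi]) r (by simp) (hL'.2.2 i hi r (by simp)).le) J hJ
    have h2 := ih hL'.1 fun i hi k hk => hF i (by simp [hi]) k (by simp [hk])
    simpa using h1.trans (h2.append_right (rowEntries F T J r))

/-! ### Sliding -/

/-- The rows `N, N - 1, …, 1`. -/
def rowsDesc (N : ℕ) : List ℕ := (List.range N).reverse.map (· + 1)

theorem mem_rowsDesc {N i : ℕ} : i ∈ rowsDesc N ↔ 1 ≤ i ∧ i ≤ N := by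
  simp only [rowsDesc, List.mem_map, List.mem_reverse, List.mem_range]
  constructor
  · rintro ⟨k, hk, rfl⟩
    omega
  · exact fun h => ⟨i - 1, by omega, by omega⟩

theorem rowsDesc_pairwise (N : ℕ) : (rowsDesc N).Pairwise (· > ·) := by
  unfold rowsDesc
  rw [List.pairwise_map, List.pairwise_reverse]
  exact List.pairwise_lt_range.imp fun h => by omega

theorem colWordP_eq (f : ℕ → ℕ) (H : Set (ℕ × ℕ)) (T : ℕ × ℕ → ℕ) (N M : ℕ) :
    colWordP f H T N M =
      (((List.range M).map (· + 1)).map (colEntries (cells f \ H) T (rowsDesc N))).flatten := by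
  unfold colWordP
  rw [List.map_map]
  congr 1
  refine List.map_congr_left fun j _ => congrArg _ (List.filter_congr fun i _ => ?_)
  exact decide_eq_decide.2 Iff.rfl

theorem rowWordP_eq {f : ℕ → ℕ} (hf : IsPartitionF f) (H : Set (ℕ × ℕ)) (T : ℕ × ℕ → ℕ)
    (N : ℕ) {M : ℕ} (hM : f 1 ≤ M) :
    rowWordP f H T N =
      ((rowsDesc N).map (rowEntries (cells f \ H) T ((List.range M).map (· + 1)))).flatten := by
  unfold rowWordP rowsDesc
  rw [List.map_map]
  congr 1
  refine List.map_congr_left fun i _ => ?_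
  have hi : f (i + 1) ≤ f 1 := hf.1 1 (i + 1) le_rfl (by omega)
  obtain ⟨d, rfl⟩ := Nat.exists_eq_add_of_le (hi.trans hM)
  have hnil : rowEntries (cells f \ H) T (((List.range d).map (f (i + 1) + ·)).map (· + 1))
      (i + 1) = [] := by
    simp only [rowEntries, List.map_eq_nil_iff, List.filter_eq_nil_iff, List.mem_map,
      decide_eq_true_eq]
    rintro _ ⟨_, ⟨k, _, rfl⟩, rfl⟩ h
    have : f (i + 1) + k + 1 ≤ f (i + 1) := h.1.2.2
    omega
  rw [Function.comp_apply, List.range_add, List.map_append, rowEntries_append, hnil,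
    List.append_nil]
  refine congrArg _ (List.filter_congr fun j hj => ?_)
  simp only [List.mem_map, List.mem_range] at hj
  obtain ⟨k, hk, rfl⟩ := hj
  have hcell : (i + 1, k + 1) ∈ cells f := ⟨by simp, by simp, by simpa using hk⟩
  exact decide_eq_decide.2 ⟨fun h => ⟨hcell, h⟩, fun h => h.2⟩

/-- Outside the first column, `F` is closed under moving up and left. -/
def ClosedOffFirstColumn (F : Set (ℕ × ℕ)) : Prop :=
  ∀ i j i' j', (i, j) ∈ F → 1 ≤ i' → i' ≤ i → 2 ≤ j' → j' ≤ j → (i', j') ∈ F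

/-- The invariant of a rectification between two slidings. -/
def RectInvariant (f : ℕ → ℕ) (H : Set (ℕ × ℕ)) (T : ℕ × ℕ → ℕ) : Prop :=
  H ⊆ cells f ∧ ClosedOffFirstColumn (cells f \ H) ∧ Semistandard (cells f \ H) T

/-- The invariant of a sliding whose current hole is `p`. -/
def SlideInvariant (f : ℕ → ℕ) (H : Set (ℕ × ℕ)) (T : ℕ × ℕ → ℕ) (p : ℕ × ℕ) : Prop :=
  p ∈ H ∧ H ⊆ cells f ∧ ClosedOffFirstColumn (insert p (cells f \ H)) ∧
  (∀ i j i', (i, j) ∈ cells f \ H → p.1 < i' → i' ≤ i → (i', 1) ∈ cells f \ H) ∧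
  Semistandard (cells f \ H) T

theorem cells_diff_moveHole {f : ℕ → ℕ} {H : Set (ℕ × ℕ)} {p q : ℕ × ℕ} (hp : p ∈ cells f)
    (hpq : p ≠ q) :
    cells f \ ((H \ {p}) ∪ {q}) = insert p ((cells f \ H) \ {q}) := by
  ext x
  simp only [Set.mem_sdiff, Set.mem_union, Set.mem_singleton_iff, Set.mem_insert_iff]
  by_cases hx : x = p
  · subst hx
    simp [hp, hpq]
  · simp [hx]
    tauto

/-- The filling obtained from `T` by moving the entry at `q` to `p`. -/
noncomputable def moveEntry (T : ℕ × ℕ → ℕ) (p q : ℕ × ℕ) : ℕ × ℕ → ℕ :=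
  Function.update (Function.update T p (T q)) q 0

theorem moveEntry_target {T : ℕ × ℕ → ℕ} {p q : ℕ × ℕ} (hpq : p ≠ q) :
    moveEntry T p q p = T q := by
  simp [moveEntry, hpq]

theorem moveEntry_of_ne {T : ℕ × ℕ → ℕ} {p q x : ℕ × ℕ} (hp : x ≠ p) (hq : x ≠ q) :
    moveEntry T p q x = T x := by
  simp [moveEntry, hp, hq]

theorem moveHole_eq {f : ℕ → ℕ} {H : Set (ℕ × ℕ)} (T : ℕ × ℕ → ℕ) {p q : ℕ × ℕ}
    (hp : p ∈ cells f) (hpq : p ≠ q) :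
    cells f \ (moveHole H T p q).1 = insert p ((cells f \ H) \ {q}) ∧
      (moveHole H T p q).2 = moveEntry T p q :=
  ⟨cells_diff_moveHole hp hpq, rfl⟩

theorem Semistandard.moveEntry {F : Set (ℕ × ℕ)} {T : ℕ × ℕ → ℕ} (hT : Semistandard F T)
    {r j : ℕ} {q : ℕ × ℕ} (hpq : (r, j) ≠ q)
    (hleft : ∀ l, (r, l) ∈ F → (r, l) ≠ q → l < j → T (r, l) ≤ T q)
    (hright : ∀ l, (r, l) ∈ F → (r, l) ≠ q → j < l → T q ≤ T (r, l))
    (habove : ∀ i, (i, j) ∈ F → (i, j) ≠ q → i < r → T (i, j) < T q)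
    (hbelow : ∀ i, (i, j) ∈ F → (i, j) ≠ q → r < i → T q < T (i, j)) :
    Semistandard (insert (r, j) (F \ {q})) (moveEntry T (r, j) q) := by
  have key : ∀ x, x ∈ insert (r, j) (F \ {q}) →
      (x = (r, j) ∧ _root_.moveEntry T (r, j) q x = T q) ∨
      (x ∈ F ∧ x ≠ q ∧ _root_.moveEntry T (r, j) q x = T x) := by
    intro x hx
    by_cases hxp : x = (r, j)
    · exact Or.inl ⟨hxp, by rw [hxp, moveEntry_target hpq]⟩
    · have hx' : x ∈ F \ {q} := hx.resolve_left hxp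
      exact Or.inr ⟨hx'.1, hx'.2, moveEntry_of_ne hxp hx'.2⟩
  constructor
  · intro i k l hk hl hkl
    rcases key _ hk with ⟨e, h⟩ | ⟨hkF, hkq, h⟩ <;> rcases key _ hl with ⟨e', h'⟩ | ⟨hlF, hlq, h'⟩ <;>
      rw [h, h']
    · obtain ⟨rfl, rfl⟩ := Prod.mk.inj e
      exact hright l hlF hlq hkl
    · obtain ⟨rfl, rfl⟩ := Prod.mk.inj e'
      exact hleft k hkF hkq hkl
    · exact hT.1 i k l hkF hlF hkl
  · intro i k l hi hk hik
    rcases key _ hi with ⟨e, h⟩ | ⟨hiF, hiq, h⟩ <;> rcases key _ hk with ⟨e', h'⟩ | ⟨hkF, hkq, h'⟩ <;>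
      rw [h, h']
    · rw [Prod.mk.injEq] at e e'
      omega
    · obtain ⟨rfl, rfl⟩ := Prod.mk.inj e
      exact hbelow k hkF hkq hik
    · obtain ⟨rfl, rfl⟩ := Prod.mk.inj e'
      exact habove i hiF hiq hik
    · exact hT.2 i k l hiF hkF hik

/-- The part of the invariant of a sliding that does not mention the order of the entries. -/
theorem SlideInvariant.of_moveHole {f : ℕ → ℕ} {H : Set (ℕ × ℕ)} {T : ℕ × ℕ → ℕ}
    {p q : ℕ × ℕ} (h : SlideInvariant f H T p) (hq : q ∈ cells f \ H) (hpq : p ≠ q)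
    (hrow : p.1 ≤ q.1) (hT : Semistandard (insert p ((cells f \ H) \ {q})) (moveEntry T p q)) :
    SlideInvariant f (moveHole H T p q).1 (moveHole H T p q).2 q := by
  obtain ⟨hpH, hHf, hclosed, hcol, -⟩ := h
  obtain ⟨hcells, hentry⟩ := moveHole_eq (H := H) T (hHf hpH) hpq
  have hinsert : insert q (cells f \ (moveHole H T p q).1) = insert p (cells f \ H) := by
    rw [hcells, Set.insert_comm, Set.insert_sdiff_singleton, Set.insert_eq_of_mem hq]
  refine ⟨by simp [moveHole], ?_, hinsert ▸ hclosed, ?_, by rwa [hcells, hentry]⟩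
  · rintro x (hx | rfl)
    · exact hHf hx.1
    · exact hq.1
  · rw [hcells]
    intro i j i' hij hi' hi'i
    have hij' : (i, j) ∈ cells f \ H := by
      rcases hij with h | h
      · rw [← h] at hrow
        simp only at hrow
        omega
      · exact h.1
    refine Or.inr ⟨hcol i j i' hij' (by omega) hi'i, fun h => ?_⟩
    rw [← (show (i', 1) = q from h)] at hi'
    simp only at hi'
    omega

theorem Semistandard.lt_of_lt_of_adjacent {F : Set (ℕ × ℕ)} {T : ℕ × ℕ → ℕ}
    (hT : Semistandard F T) {a r i j : ℕ} (h : (r + 1, j) ∈ F → a < T (r + 1, j))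
    (hadj : (r + 1, j) ∈ F) (hi : (i, j) ∈ F) (hri : r < i) : a < T (i, j) := by
  rcases Nat.eq_or_lt_of_le (Nat.succ_le_of_lt hri) with rfl | hlt
  · exact h hadj
  · exact (h hadj).trans (hT.2 _ _ _ hadj hi hlt)

theorem SlideInvariant.mem_below {f : ℕ → ℕ} {H : Set (ℕ × ℕ)} {T : ℕ × ℕ → ℕ}
    {p : ℕ × ℕ} (h : SlideInvariant f H T p) {i j i' j' : ℕ} (hij : (i, j) ∈ cells f \ H)
    (hi' : p.1 < i') (hi'i : i' ≤ i) (hj' : 1 ≤ j') (hj'j : j' ≤ j) :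
    (i', j') ∈ cells f \ H := by
  obtain ⟨-, -, hclosed, hcol, -⟩ := h
  rcases Nat.eq_or_lt_of_le hj' with rfl | hlt
  · exact hcol i j i' hij hi' hi'i
  · refine (hclosed i j i' j' (Or.inr hij) (by omega) hi'i hlt hj'j).resolve_left fun h => ?_
    rw [← h] at hi'
    simp at hi'

theorem SlideInvariant.moveRight {f : ℕ → ℕ} {H : Set (ℕ × ℕ)} {T : ℕ × ℕ → ℕ} {r j : ℕ}
    (h : SlideInvariant f H T (r, j)) (hq : (r, j + 1) ∈ cells f \ H)
    (hlt : (r + 1, j) ∈ cells f \ H → T (r, j + 1) < T (r + 1, j)) :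
    SlideInvariant f (moveHole H T (r, j) (r, j + 1)).1 (moveHole H T (r, j) (r, j + 1)).2
      (r, j + 1) := by
  have hpq : (r, j) ≠ (r, j + 1) := by simp
  refine h.of_moveHole hq hpq le_rfl ?_
  obtain ⟨hpH, hHf, hclosed, hcol, hT⟩ := id h
  have hj : 1 ≤ j := (hHf hpH).2.1
  refine hT.moveEntry hpq (fun l hl _ hlj => hT.1 _ _ _ hl hq (by omega))
    (fun l hl hne hjl => hT.1 _ _ _ hq hl ?_) (fun i hi _ hir => ?_) (fun i hi _ hri => ?_)
  · have : l ≠ j + 1 := fun e => hne (by rw [e])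
    omega
  · have hi1 : 1 ≤ i := hi.1.1
    have hi' : (i, j + 1) ∈ cells f \ H :=
      (hclosed r (j + 1) i (j + 1) (Or.inr hq) hi1 hir.le (by omega) le_rfl).resolve_left (by simp)
    exact (hT.1 _ _ _ hi hi' (by omega)).trans_lt (hT.2 _ _ _ hi' hq hir)
  · exact hT.lt_of_lt_of_adjacent hlt (h.mem_below hi (by simp) hri hj le_rfl) hi hri

theorem SlideInvariant.moveDown {f : ℕ → ℕ} {H : Set (ℕ × ℕ)} {T : ℕ × ℕ → ℕ} {r j : ℕ}
    (h : SlideInvariant f H T (r, j)) (hq : (r + 1, j) ∈ cells f \ H)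
    (hle : (r, j + 1) ∈ cells f \ H → T (r + 1, j) ≤ T (r, j + 1)) :
    SlideInvariant f (moveHole H T (r, j) (r + 1, j)).1 (moveHole H T (r, j) (r + 1, j)).2
      (r + 1, j) := by
  have hpq : (r, j) ≠ (r + 1, j) := by simp
  refine h.of_moveHole hq hpq (by simp) ?_
  obtain ⟨hpH, hHf, hclosed, hcol, hT⟩ := id h
  have hj : 1 ≤ j := (hHf hpH).2.1
  have hr : 1 ≤ r := (hHf hpH).1
  refine hT.moveEntry hpq (fun l hl _ hlj => ?_) (fun l hl hne hjl => ?_)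
    (fun i hi _ hir => hT.2 _ _ _ hi hq (by omega))
    (fun i hi hne hri => hT.2 _ _ _ hq hi ?_)
  · have hl' : (r + 1, l) ∈ cells f \ H := h.mem_below hq (by simp) le_rfl hl.1.2.1 hlj.le
    exact (hT.2 _ _ _ hl hl' (by omega)).le.trans (hT.1 _ _ _ hl' hq hlj)
  · have hadj : (r, j + 1) ∈ cells f \ H :=
      (hclosed r l r (j + 1) (Or.inr hl) hr le_rfl (by omega) hjl).resolve_left (by simp)
    rcases Nat.eq_or_lt_of_le (Nat.succ_le_of_lt hjl) with rfl | hlt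
    · exact hle hadj
    · exact (hle hadj).trans (hT.1 _ _ _ hadj hl hlt)
  · have : i ≠ r + 1 := fun e => hne (by rw [e])
    omega

theorem colEntries_moveEntry_of_ne {F : Set (ℕ × ℕ)} {T : ℕ × ℕ → ℕ} {p q : ℕ × ℕ}
    {L : List ℕ} {j : ℕ} (h : ∀ i ∈ L, (i, j) ≠ p ∧ (i, j) ≠ q) :
    colEntries (insert p (F \ {q})) (moveEntry T p q) L j = colEntries F T L j := by
  refine colEntries_congr fun i hi => ⟨?_, moveEntry_of_ne (h i hi).1 (h i hi).2⟩
  simp [h i hi]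

theorem rowsDesc_split {N r : ℕ} (hr : 1 ≤ r) (hrN : r ≤ N) :
    ∃ L L', rowsDesc N = L ++ r :: L' ∧ (∀ i ∈ L, r < i) ∧ ∀ i ∈ L', 1 ≤ i ∧ i < r := by
  obtain ⟨L, L', hL⟩ := List.append_of_mem (mem_rowsDesc.2 ⟨hr, hrN⟩)
  have hp := rowsDesc_pairwise N
  rw [hL, List.pairwise_append] at hp
  refine ⟨L, L', hL, fun i hi => hp.2.2 i hi r (by simp), fun i hi => ⟨?_, ?_⟩⟩
  · exact (mem_rowsDesc.1 (by rw [hL]; simp [hi])).1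
  · exact (List.pairwise_cons.1 hp.2.1).1 i hi

theorem SlideInvariant.knuth_moveDown {f : ℕ → ℕ} {H : Set (ℕ × ℕ)} {T : ℕ × ℕ → ℕ} {r j : ℕ}
    (h : SlideInvariant f H T (r, j)) (hq : (r + 1, j) ∈ cells f \ H) {N : ℕ}
    (hN : ∀ i, N < i → f i = 0) (M : ℕ) :
    Knuth (colWordP f H T N M) (colWordP f (moveHole H T (r, j) (r + 1, j)).1
      (moveHole H T (r, j) (r + 1, j)).2 N M) := by
  have hpq : (r, j) ≠ (r + 1, j) := by simp
  have hp : (r, j) ∈ cells f := h.2.1 h.1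
  have hpF : (r, j) ∉ cells f \ H := fun h' => h'.2 h.1
  obtain ⟨hcells, hentry⟩ := moveHole_eq (H := H) T hp hpq
  rw [colWordP_eq, colWordP_eq, hcells, hentry]
  refine Knuth.of_eq (congrArg _ (List.map_congr_left fun l _ => ?_))
  by_cases hl : l = j
  swap
  · exact (colEntries_moveEntry_of_ne fun i _ => by simp [hl]).symm
  subst hl
  have hrN : r + 1 ≤ N := by
    by_contra hlt
    have h1 := hq.1.2
    simp only [hN (r + 1) (by omega)] at h1
    omega
  obtain ⟨L, L', hL, hgt, hlt⟩ := rowsDesc_split (by omega) hrN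
  have hrL : r ∈ L ++ (r + 1) :: L' := hL ▸ mem_rowsDesc.2 ⟨hp.1, by omega⟩
  obtain ⟨L'', rfl⟩ : ∃ L'', L' = r :: L'' := by
    have hrL' : r ∈ L' := by
      simp only [List.mem_append, List.mem_cons] at hrL
      rcases hrL with h' | h' | h'
      · have := hgt r h'
        omega
      · omega
      · exact h'
    cases L' with
    | nil => simp at hrL'
    | cons d L'' =>
      have hd := hlt d (by simp)
      have hpw := rowsDesc_pairwise N
      rw [hL] at hpw
      have hpw' := (List.pairwise_cons.1 (List.pairwise_cons.1 (List.pairwise_append.1 hpw).2.1).2).1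
      rcases List.mem_cons.1 hrL' with rfl | h'
      · exact ⟨L'', rfl⟩
      · have := hpw' r h'
        omega
  have hlt' : ∀ i ∈ L'', i < r := by
    have hpw := rowsDesc_pairwise N
    rw [hL] at hpw
    exact (List.pairwise_cons.1 (List.pairwise_cons.1 (List.pairwise_append.1 hpw).2.1).2).1
  rw [hL, colEntries_append, colEntries_append, colEntries_cons_of_mem T _ hq,
    colEntries_cons_of_notMem T _ hpF, colEntries_cons_of_notMem _ _ (by simp),
    colEntries_cons_of_mem _ _ (Set.mem_insert _ _), moveEntry_target hpq,
    colEntries_moveEntry_of_ne fun i hi => ?_, colEntries_moveEntry_of_ne fun i hi => ?_]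
  · have := hlt' i hi
    simp only [ne_eq, Prod.mk.injEq]
    omega
  · have := hgt i hi
    simp only [ne_eq, Prod.mk.injEq]
    omega

theorem SlideInvariant.knuth_moveRight {f : ℕ → ℕ} (hf : IsPartitionF f) {H : Set (ℕ × ℕ)}
    {T : ℕ × ℕ → ℕ} {r j : ℕ} (h : SlideInvariant f H T (r, j))
    (hq : (r, j + 1) ∈ cells f \ H)
    (hlt : (r + 1, j) ∈ cells f \ H → T (r, j + 1) < T (r + 1, j)) {N M : ℕ}
    (hN : ∀ i, N < i → f i = 0) (hM : f 1 ≤ M) :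
    Knuth (colWordP f H T N M) (colWordP f (moveHole H T (r, j) (r, j + 1)).1
      (moveHole H T (r, j) (r, j + 1)).2 N M) := by
  have hpq : (r, j) ≠ (r, j + 1) := by simp
  have hp : (r, j) ∈ cells f := h.2.1 h.1
  have hpF : (r, j) ∉ cells f \ H := fun h' => h'.2 h.1
  have hr : 1 ≤ r := hp.1
  have hj : 1 ≤ j := hp.2.1
  obtain ⟨hcells, hentry⟩ := moveHole_eq (H := H) T hp hpq
  have hT' := (h.moveRight hq hlt).2.2.2.2
  rw [hcells, hentry] at hT'
  have hT := h.2.2.2.2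
  rw [colWordP_eq, colWordP_eq, hcells, hentry]
  have hjM : j + 1 ≤ M := (hq.1.2.2.trans (hf.1 1 r le_rfl hr)).trans hM
  have hrN : r ≤ N := by
    by_contra hlt
    have h1 := hq.1.2
    simp only [hN r (by omega)] at h1
    omega
  obtain ⟨k, rfl⟩ : ∃ k, j = k + 1 := ⟨j - 1, by omega⟩
  obtain ⟨d, rfl⟩ := Nat.exists_eq_add_of_le hjM
  have hrange : (List.range (k + 1 + 1 + d)).map (· + 1) =
      (List.range k).map (· + 1) ++ [k + 1, k + 1 + 1] ++
        (List.range d).map (k + 1 + 1 + · + 1) := by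
    simp [List.range_add, List.range_succ, Function.comp_def]
  have hother : ∀ J : List ℕ, (∀ l ∈ J, l ≠ k + 1 ∧ l ≠ k + 1 + 1) →
      J.map (colEntries (insert (r, k + 1) ((cells f \ H) \ {(r, k + 1 + 1)}))
        (moveEntry T (r, k + 1) (r, k + 1 + 1)) (rowsDesc N)) =
      J.map (colEntries (cells f \ H) T (rowsDesc N)) := fun J hJ =>
    List.map_congr_left fun l hl => colEntries_moveEntry_of_ne fun i _ => by simp [hJ l hl]
  rw [hrange]
  simp only [List.map_append, List.flatten_append]
  rw [hother ((List.range k).map (· + 1)) fun l hl => ?_,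
    hother ((List.range d).map (k + 1 + 1 + · + 1)) fun l hl => ?_]
  rotate_left
  · simp only [List.mem_map, List.mem_range] at hl
    omega
  · simp only [List.mem_map, List.mem_range] at hl
    omega
  refine Knuth.context ?_ _ _
  obtain ⟨L, L', hL, hgt, hlt'⟩ := rowsDesc_split hr hrN
  have hpw := rowsDesc_pairwise N
  have hc := hT'.colEntries_pairwise hpw (k + 1)
  have hc' := hT.colEntries_pairwise hpw (k + 1 + 1)
  have hneL : ∀ l, ∀ i ∈ L, (i, l) ≠ (r, k + 1) ∧ (i, l) ≠ (r, k + 1 + 1) := fun l i hi => by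
    have := hgt i hi
    simp only [ne_eq, Prod.mk.injEq]
    omega
  have hneL' : ∀ l, ∀ i ∈ L', (i, l) ≠ (r, k + 1) ∧ (i, l) ≠ (r, k + 1 + 1) := fun l i hi => by
    have := hlt' i hi
    simp only [ne_eq, Prod.mk.injEq]
    omega
  have e1 : colEntries (insert (r, k + 1) ((cells f \ H) \ {(r, k + 1 + 1)}))
      (moveEntry T (r, k + 1) (r, k + 1 + 1)) (rowsDesc N) (k + 1) =
      colEntries (cells f \ H) T L (k + 1) ++
        T (r, k + 1 + 1) :: colEntries (cells f \ H) T L' (k + 1) := by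
    rw [hL, colEntries_append, colEntries_cons_of_mem _ _ (Set.mem_insert _ _),
      moveEntry_target hpq, colEntries_moveEntry_of_ne (hneL _),
      colEntries_moveEntry_of_ne (hneL' _)]
  have e2 : colEntries (insert (r, k + 1) ((cells f \ H) \ {(r, k + 1 + 1)}))
      (moveEntry T (r, k + 1) (r, k + 1 + 1)) (rowsDesc N) (k + 1 + 1) =
      colEntries (cells f \ H) T L (k + 1 + 1) ++ colEntries (cells f \ H) T L' (k + 1 + 1) := by
    rw [hL, colEntries_append, colEntries_cons_of_notMem _ _ (by simp),
      colEntries_moveEntry_of_ne (hneL _), colEntries_moveEntry_of_ne (hneL' _)]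
  have e3 : colEntries (cells f \ H) T (rowsDesc N) (k + 1) =
      colEntries (cells f \ H) T L (k + 1) ++ colEntries (cells f \ H) T L' (k + 1) := by
    rw [hL, colEntries_append, colEntries_cons_of_notMem _ _ hpF]
  have e4 : colEntries (cells f \ H) T (rowsDesc N) (k + 1 + 1) =
      colEntries (cells f \ H) T L (k + 1 + 1) ++
        T (r, k + 1 + 1) :: colEntries (cells f \ H) T L' (k + 1 + 1) := by
    rw [hL, colEntries_append, colEntries_cons_of_mem _ _ hq]
  simp only [List.map_cons, List.map_nil, List.flatten_cons, List.flatten_nil, List.append_nil]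
  rw [e1] at hc
  rw [e4] at hc'
  rw [e1, e2, e3, e4]
  refine knuth_two_columns hc (List.pairwise_append.1 hc').2.1
    (colEntries_sublistForall₂ fun i hi hi' => ?_) (colEntries_sublistForall₂ fun i hi hi' => ?_)
  · have hmem := h.mem_below hi' (hgt i hi) le_rfl hj (Nat.le_succ _)
    exact ⟨hmem, hT.1 _ _ _ hmem hi' (by omega)⟩
  · obtain ⟨hi1, hir⟩ := hlt' i hi
    have hmem : (i, k + 1 + 1) ∈ cells f \ H :=
      (h.2.2.1 r (k + 1 + 1) i (k + 1 + 1) (Or.inr hq) hi1 hir.le (by omega) le_rfl).resolve_left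
        (by simp)
    exact ⟨hmem, hT.1 _ _ _ hi' hmem (by omega)⟩

theorem SlideInvariant.of_reflTransGen {f : ℕ → ℕ} (hf : IsPartitionF f) {N M : ℕ}
    (hN : ∀ i, N < i → f i = 0) (hM : f 1 ≤ M)
    {s t : Set (ℕ × ℕ) × (ℕ × ℕ → ℕ) × (ℕ × ℕ)} (hs : SlideInvariant f s.1 s.2.1 s.2.2)
    (hst : Relation.ReflTransGen (SlideStep f) s t) :
    SlideInvariant f t.1 t.2.1 t.2.2 ∧
      Knuth (colWordP f s.1 s.2.1 N M) (colWordP f t.1 t.2.1 N M) := by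
  induction hst with
  | refl => exact ⟨hs, Knuth.refl _⟩
  | @tail u v _ huv ih =>
    obtain ⟨H, T, r, j⟩ := u
    obtain ⟨hu, hK⟩ := ih
    rcases huv with ⟨hq, hlt, rfl⟩ | ⟨hq, hle, rfl⟩
    · exact ⟨hu.moveRight hq hlt, hK.trans (hu.knuth_moveRight hf hq hlt hN hM)⟩
    · exact ⟨hu.moveDown hq hle, hK.trans (hu.knuth_moveDown hq hN M)⟩

/-- Below a row in which no further hole of the first column can slide, the filled cells of the
first column are closed under moving up. -/
theorem mem_first_column_of_not_slidable {f : ℕ → ℕ} (hf : IsPartitionF f) {H : Set (ℕ × ℕ)}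
    (hclosed : ClosedOffFirstColumn (cells f \ H)) {r : ℕ}
    (hr : ∀ i, r < i → ¬ Slidable f H (i, 1)) {i j i' : ℕ} (hij : (i, j) ∈ cells f \ H)
    (hi' : r < i') (hi'i : i' ≤ i) : (i', 1) ∈ cells f \ H := by
  have hcell : ∀ k, r < k → k ≤ i → (k, 1) ∈ cells f := fun k hk hki =>
    ⟨by simp only; omega, le_rfl, (hij.1.2.1.trans hij.1.2.2).trans (hf.1 k i (by omega) hki)⟩
  obtain ⟨d, rfl⟩ := Nat.exists_eq_add_of_le hi'i
  induction d generalizing i' with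
  | zero =>
    refine ⟨hcell _ hi' le_rfl, fun hH => ?_⟩
    have hj : 1 ≤ j := hij.1.2.1
    rcases Nat.eq_or_lt_of_le hj with rfl | hlt
    · exact hij.2 hH
    · exact hr _ hi' ⟨hH, Or.inl (hclosed _ j _ 2 hij (by omega) le_rfl le_rfl hlt)⟩
  | succ d ih =>
    refine ⟨hcell i' hi' hi'i, fun hH => hr i' hi' ⟨hH, Or.inr ?_⟩⟩
    have e : i' + (d + 1) = i' + 1 + d := by omega
    rw [e] at hij hcell
    exact ih (by simp only; omega) hij (by simp only; omega) hcell

theorem RectInvariant.slideInvariant {f : ℕ → ℕ} (hf : IsPartitionF f) {H : Set (ℕ × ℕ)}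
    {T : ℕ × ℕ → ℕ} (h : RectInvariant f H T) {p : ℕ × ℕ} (hp : LatestSlidable f H p) :
    SlideInvariant f H T p := by
  obtain ⟨hHf, hclosed, hT⟩ := h
  obtain ⟨⟨hpH, hadj⟩, hlatest⟩ := hp
  obtain ⟨r, j⟩ := p
  obtain ⟨hr, hj, hjf⟩ := hHf hpH
  simp only at hr hj hjf hadj hlatest
  have hj1 : j = 1 := by
    by_contra hne
    rcases hadj with h | h
    · exact (hclosed r (j + 1) r j h hr le_rfl (by omega) (by omega)).2 hpH
    · exact (hclosed (r + 1) j r j h hr (by omega) (by omega) le_rfl).2 hpH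
  subst hj1
  refine ⟨hpH, hHf, ?_, fun i l i' hil hi' hi'i => ?_, hT⟩
  · intro i l i' l' hil hi' hi'i hl' hl'l
    rcases hil with h | h
    · rw [Prod.mk.injEq] at h
      omega
    · exact Or.inr (hclosed i l i' l' h hi' hi'i hl' hl'l)
  · refine mem_first_column_of_not_slidable hf hclosed (fun k hk hs => ?_) hil hi' hi'i
    have := hlatest _ hs
    simp only at this
    omega

theorem SlideInvariant.rectInvariant {f : ℕ → ℕ} {H : Set (ℕ × ℕ)} {T : ℕ × ℕ → ℕ}
    {p : ℕ × ℕ} (h : SlideInvariant f H T p) (hp : ¬ Slidable f H p) : RectInvariant f H T := by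
  obtain ⟨hpH, hHf, hclosed, -, hT⟩ := h
  refine ⟨hHf, fun i j i' j' hij hi' hi'i hj' hj'j => ?_, hT⟩
  refine (hclosed i j i' j' (Or.inr hij) hi' hi'i hj' hj'j).resolve_left ?_
  rintro rfl
  refine hp ⟨hpH, ?_⟩
  have hne : ¬ (i' = i ∧ j' = j) := by
    rintro ⟨rfl, rfl⟩
    exact hij.2 hpH
  rcases Nat.eq_or_lt_of_le hj'j with hjj | hlt
  · exact Or.inr ((hclosed i j (i' + 1) j' (Or.inr hij) (by omega) (by omega) hj' hj'j).resolve_left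
      (by simp))
  · exact Or.inl ((hclosed i j i' (j' + 1) (Or.inr hij) hi' hi'i (by omega) hlt).resolve_left
      (by simp))

theorem RectInvariant.of_reflTransGen {f : ℕ → ℕ} (hf : IsPartitionF f) {N M : ℕ}
    (hN : ∀ i, N < i → f i = 0) (hM : f 1 ≤ M) {s t : Set (ℕ × ℕ) × (ℕ × ℕ → ℕ)}
    (hs : RectInvariant f s.1 s.2) (hst : Relation.ReflTransGen (RectStep f) s t) :
    RectInvariant f t.1 t.2 ∧ Knuth (colWordP f s.1 s.2 N M) (colWordP f t.1 t.2 N M) := by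
  induction hst with
  | refl => exact ⟨hs, Knuth.refl _⟩
  | tail _ huv ih =>
    obtain ⟨p, p', hp, hslide, hp'⟩ := huv
    have h := SlideInvariant.of_reflTransGen hf hN hM (ih.1.slideInvariant hf hp) hslide
    exact ⟨h.1.rectInvariant hp', ih.2.trans h.2⟩

/-- The row and the column reading agree up to Knuth equivalence once no hole can slide. -/
theorem RectInvariant.knuth_rowWordP_colWordP {f : ℕ → ℕ} (hf : IsPartitionF f)
    {H : Set (ℕ × ℕ)} {T : ℕ × ℕ → ℕ} (h : RectInvariant f H T)
    (hterm : ∀ q, ¬ Slidable f H q) (N : ℕ) {M : ℕ} (hM : f 1 ≤ M) :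
    Knuth (rowWordP f H T N) (colWordP f H T N M) := by
  obtain ⟨-, hclosed, hT⟩ := h
  rw [colWordP_eq, rowWordP_eq hf H T N hM]
  refine (knuth_column_reading_row_reading hT _ (rowsDesc_pairwise N) ?_ _ ?_).symm
  · intro i _ k hk hki j hij
    have hk1 := (mem_rowsDesc.1 hk).1
    have hj : 1 ≤ j := hij.1.2.1
    rcases Nat.eq_or_lt_of_le hj with rfl | hlt
    · exact mem_first_column_of_not_slidable hf hclosed (fun i _ => hterm (i, 1)) hij hk1 hki
    · exact hclosed i j k j hij hk1 hki hlt le_rfl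
  · rw [List.pairwise_map]
    exact List.pairwise_lt_range.imp fun h => by omega

theorem stmt11 (f : ℕ → ℕ) (hf : IsPartitionF f) (H : Set (ℕ × ℕ)) (hH : H ⊆ cells f)
    (hH1 : ∀ p ∈ H, p.2 = 1)
    (T : ℕ × ℕ → ℕ) (hT : PSSYT f H T)
    (H' : Set (ℕ × ℕ)) (T' : ℕ × ℕ → ℕ)
    (hrect : Relation.ReflTransGen (RectStep f) (H, T) (H', T'))
    (hterm : ∀ q, ¬ Slidable f H' q)
    (N M : ℕ) (hN : ∀ i, N < i → f i = 0) (hM : f 1 ≤ M) :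
    Knuth (rowWordP f H' T' N) (colWordP f H T N M) := by
  have hinv : RectInvariant f H T := by
    refine ⟨hH, fun i j i' j' hij hi' hi'i hj' hj'j => ⟨⟨hi', by simp only; omega, ?_⟩, ?_⟩, hT.2⟩
    · exact (hj'j.trans hij.1.2.2).trans (hf.1 i' i hi' hi'i)
    · intro h
      have := hH1 _ h
      simp only at this
      omega
  obtain ⟨hinv', hK⟩ := RectInvariant.of_reflTransGen hf hN hM hinv hrect
  exact (hinv'.knuth_rowWordP_colWordP hf hterm N hM).trans hK.symm
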